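/- Let k be an even positive integer and suppose f : ℍ → ℂ satisfies f|_k T = f, f|_k H₁₁ = ε f for some ε ∈ {1,-1}, f|_k W₁₁ = f, and f|_k T₃ = c₃ f for some c₃ ∈ ℂ. Then (f − f|_k([[3,-1],[-11,4]]))|_k β(1/3) + (f − f|_k([[3,1],[11,4]]))|_k β(−1/3) = 0. -/

import Mathlib

open Complex UpperHalfPlane Matrix

/-- Möbius transform of `z ∈ ℍ` under a real 2×2 matrix, as a complex number. -/
noncomputable def moebius (γ : Matrix (Fin 2) (Fin 2) ℝ) (z : ℍ) : ℂ :=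
  ((γ 0 0 : ℂ) * (z : ℂ) + (γ 0 1 : ℂ)) / ((γ 1 0 : ℂ) * (z : ℂ) + (γ 1 1 : ℂ))

/-- Action of a real 2×2 matrix on the upper half-plane.  When the matrix has
positive determinant the Möbius image lies in `ℍ` and the `dite` takes the
first branch, so this agrees with the usual fractional linear action. -/
noncomputable def act (γ : Matrix (Fin 2) (Fin 2) ℝ) (z : ℍ) : ℍ :=
  if h : 0 < (moebius γ z).im then ⟨moebius γ z, h⟩ else z

/-- Weight-`k` slash action `f ∣[k] γ` with the classical normalization
`(det γ)^(k/2) (cz+d)^(-k) f(γz)` (for `k` even, `det γ > 0`). -/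
noncomputable def slash (k : ℤ) (γ : Matrix (Fin 2) (Fin 2) ℝ) (f : ℍ → ℂ) : ℍ → ℂ :=
  fun z => ((γ.det : ℂ) ^ (k / 2)) * (((γ 1 0 : ℂ) * (z : ℂ) + (γ 1 1 : ℂ)) ^ (-k)) * f (act γ z)

/-- The Hecke operator `T_n` (trivial character):
`f ∣[k] T_n = Σ_{ad = n, a,d > 0, 0 ≤ b < d} f ∣[k] [[a,b],[0,d]]`. -/
noncomputable def hecke (k : ℤ) (n : ℕ) (f : ℍ → ℂ) : ℍ → ℂ :=
  fun z => ∑ a ∈ n.divisors, ∑ b ∈ Finset.range (n / a),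
    slash k !![(a : ℝ), (b : ℝ); 0, ((n / a : ℕ) : ℝ)] f z

/-- The matrix `T = [[1,1],[0,1]]`. -/
noncomputable def Tmat : Matrix (Fin 2) (Fin 2) ℝ := !![1, 1; 0, 1]

/-- The Fricke matrix `H_N = [[0,-1],[N,0]]`. -/
noncomputable def Hmat (N : ℕ) : Matrix (Fin 2) (Fin 2) ℝ := !![0, -1; (N : ℝ), 0]

/-- The matrix `W_N = [[1,0],[N,1]]`. -/
noncomputable def Wmat (N : ℕ) : Matrix (Fin 2) (Fin 2) ℝ := !![1, 0; (N : ℝ), 1]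

/-- The matrix `β(x) = [[1,x],[0,1]]`. -/
noncomputable def betaMat (x : ℝ) : Matrix (Fin 2) (Fin 2) ℝ := !![1, x; 0, 1]
theorem moebius_denom_ne_zero {γ : Matrix (Fin 2) (Fin 2) ℝ} (hγ : 0 < γ.det) (z : ℍ) :
    (γ 1 0 : ℂ) * (z : ℂ) + (γ 1 1 : ℂ) ≠ 0 := by
  intro h
  have hc : γ 1 0 = 0 := by
    have him := congrArg Complex.im h
    simpa [z.im_ne_zero] using him
  have hd : γ 1 1 = 0 := by simpa [hc] using h
  simp [Matrix.det_fin_two, hc, hd] at hγ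

theorem moebius_im_pos {γ : Matrix (Fin 2) (Fin 2) ℝ} (hγ : 0 < γ.det) (z : ℍ) :
    0 < (moebius γ z).im := by
  have hn := Complex.normSq_pos.mpr (moebius_denom_ne_zero hγ z)
  have him : (moebius γ z).im =
      γ.det * z.im / Complex.normSq ((γ 1 0 : ℂ) * (z : ℂ) + (γ 1 1 : ℂ)) := by
    simp only [moebius, Complex.div_im, Matrix.det_fin_two]
    simp
    ring
  rw [him]
  exact div_pos (mul_pos hγ z.im_pos) hn

theorem coe_act {γ : Matrix (Fin 2) (Fin 2) ℝ} (hγ : 0 < γ.det) (z : ℍ) :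
    (act γ z : ℂ) = moebius γ z := by
  rw [act, dif_pos (moebius_im_pos hγ z)]

/-- The cocycle relation for the automorphy factor. -/
theorem denom_mul {γ δ : Matrix (Fin 2) (Fin 2) ℝ} (hδ : 0 < δ.det) (z : ℍ) :
    ((γ * δ) 1 0 : ℂ) * (z : ℂ) + ((γ * δ) 1 1 : ℂ) =
      ((γ 1 0 : ℂ) * (act δ z : ℂ) + (γ 1 1 : ℂ)) * ((δ 1 0 : ℂ) * (z : ℂ) + (δ 1 1 : ℂ)) := by
  have h := moebius_denom_ne_zero hδ z
  rw [coe_act hδ, moebius, add_mul, mul_assoc, div_mul_cancel₀ _ h]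
  simp only [Matrix.mul_apply, Fin.sum_univ_two]
  push_cast
  ring

theorem act_mul {γ δ : Matrix (Fin 2) (Fin 2) ℝ} (hγ : 0 < γ.det) (hδ : 0 < δ.det) (z : ℍ) :
    act (γ * δ) z = act γ (act δ z) := by
  have hγδ : 0 < (γ * δ).det := by rw [Matrix.det_mul]; exact mul_pos hγ hδ
  have h := moebius_denom_ne_zero hδ z
  apply UpperHalfPlane.ext
  have hnum : ((γ * δ) 0 0 : ℂ) * (z : ℂ) + ((γ * δ) 0 1 : ℂ) =
      ((γ 0 0 : ℂ) * (act δ z : ℂ) + (γ 0 1 : ℂ)) * ((δ 1 0 : ℂ) * (z : ℂ) + (δ 1 1 : ℂ)) := by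
    rw [coe_act hδ, moebius, add_mul, mul_assoc, div_mul_cancel₀ _ h]
    simp only [Matrix.mul_apply, Fin.sum_univ_two]
    push_cast
    ring
  rw [coe_act hγδ, coe_act hγ, moebius, moebius, denom_mul hδ, hnum, mul_div_mul_right _ _ h]

theorem slash_mul (k : ℤ) {γ δ : Matrix (Fin 2) (Fin 2) ℝ} (hγ : 0 < γ.det) (hδ : 0 < δ.det)
    (f : ℍ → ℂ) : slash k (γ * δ) f = slash k δ (slash k γ f) := by
  funext z
  simp only [slash]
  rw [denom_mul hδ, act_mul hγ hδ, Matrix.det_mul, Complex.ofReal_mul, mul_zpow, mul_zpow]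
  ring

theorem slash_smul_matrix {k : ℤ} (hk : Even k) {r : ℝ} (hr : r ≠ 0)
    {γ : Matrix (Fin 2) (Fin 2) ℝ} (hγ : 0 < γ.det) (f : ℍ → ℂ) :
    slash k (r • γ) f = slash k γ f := by
  have hr' : (r : ℂ) ≠ 0 := Complex.ofReal_ne_zero.mpr hr
  have hdet : (r • γ).det = r ^ 2 * γ.det := by simp
  have hrγ : 0 < (r • γ).det := by rw [hdet]; positivity
  funext z
  have hact : act (r • γ) z = act γ z := by
    apply UpperHalfPlane.ext
    rw [coe_act hrγ, coe_act hγ, moebius, moebius]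
    conv_rhs => rw [← mul_div_mul_left _ _ hr']
    simp only [Matrix.smul_apply, smul_eq_mul]
    push_cast
    congr 1 <;> ring
  have hden : ((r • γ) 1 0 : ℂ) * (z : ℂ) + ((r • γ) 1 1 : ℂ) =
      r * ((γ 1 0 : ℂ) * (z : ℂ) + (γ 1 1 : ℂ)) := by
    simp only [Matrix.smul_apply, smul_eq_mul]
    push_cast
    ring
  obtain ⟨m, rfl⟩ := hk
  have hm : (m + m) / 2 = m := by omega
  simp only [slash]
  rw [hact, hden, hdet, hm, Complex.ofReal_mul, Complex.ofReal_pow, mul_zpow, mul_zpow,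
    ← zpow_natCast, ← _root_.zpow_mul]
  have hcancel : (r : ℂ) ^ (((2 : ℕ) : ℤ) * m) * (r : ℂ) ^ (-(m + m)) = 1 := by
    rw [← zpow_add₀ hr']
    have : ((2 : ℕ) : ℤ) * m + -(m + m) = 0 := by push_cast; ring
    rw [this, zpow_zero]
  linear_combination ((γ.det : ℂ) ^ m * ((γ 1 0 : ℂ) * (z : ℂ) + (γ 1 1 : ℂ)) ^ (-(m + m)) *
    f (act γ z)) * hcancel

/-- Slash actions by matrices whose products agree up to a nonzero scalar. -/
theorem slash_slash_of_mul_eq_smul {k : ℤ} (hk : Even k) {γ δ η : Matrix (Fin 2) (Fin 2) ℝ}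
    {r : ℝ} (hγ : 0 < γ.det) (hδ : 0 < δ.det) (hη : 0 < η.det) (hr : r ≠ 0)
    (h : γ * δ = r • η) (f : ℍ → ℂ) : slash k δ (slash k γ f) = slash k η f := by
  rw [← slash_mul k hγ hδ, h, slash_smul_matrix hk hr hη]

theorem slash_add (k : ℤ) (γ : Matrix (Fin 2) (Fin 2) ℝ) (f g : ℍ → ℂ) :
    slash k γ (f + g) = slash k γ f + slash k γ g := by
  funext z
  simp only [slash, Pi.add_apply]
  ring

theorem slash_sub (k : ℤ) (γ : Matrix (Fin 2) (Fin 2) ℝ) (f g : ℍ → ℂ) :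
    slash k γ (f - g) = slash k γ f - slash k γ g := by
  funext z
  simp only [slash, Pi.sub_apply]
  ring

theorem slash_smul (k : ℤ) (γ : Matrix (Fin 2) (Fin 2) ℝ) (c : ℂ) (f : ℍ → ℂ) :
    slash k γ (c • f) = c • slash k γ f := by
  funext z
  simp only [slash, Pi.smul_apply, smul_eq_mul]
  ring

theorem hecke_three (k : ℤ) (f : ℍ → ℂ) :
    hecke k 3 f = slash k !![1, 0; 0, 3] f + slash k !![1, 1; 0, 3] f +
      slash k !![1, 2; 0, 3] f + slash k !![3, 0; 0, 1] f := by
  funext z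
  have hdiv : Nat.divisors 3 = {1, 3} := by decide
  simp [hecke, hdiv, Finset.sum_range_succ]

/-- Conjugating the Hecke operator `T₃` by the Fricke involution. -/
theorem slash_lower_add_eq_slash_upper_add {k : ℤ} (hk : Even k) {f : ℍ → ℂ} {ε c₃ : ℂ}
    (hε : ε = 1 ∨ ε = -1) (hT : slash k Tmat f = f) (hH : slash k (Hmat 11) f = ε • f)
    (h3 : hecke k 3 f = c₃ • f) :
    slash k !![3, 0; -11, 1] f + slash k !![3, 0; 11, 1] f =
      slash k !![1, 1; 0, 3] f + slash k !![1, -1; 0, 3] f := by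
  have hεε : ε * ε = 1 := by rcases hε with rfl | rfl <;> norm_num
  have hHdet : 0 < (Hmat 11).det := by simp [Hmat, Matrix.det_fin_two]
  have hfH : f = ε • slash k (Hmat 11) f := by rw [hH, smul_smul, hεε, one_smul]
  have hshift : slash k !![1, 2; 0, 3] f = slash k !![1, -1; 0, 3] f := by
    conv_rhs => rw [← hT]
    refine (slash_slash_of_mul_eq_smul (r := 1) hk ?_ ?_ ?_ one_ne_zero ?_ f).symm
    · simp [Tmat, Matrix.det_fin_two]
    · simp [Matrix.det_fin_two]
    · simp [Matrix.det_fin_two]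
    · ext i j
      fin_cases i <;> fin_cases j <;> norm_num [Tmat, Matrix.mul_apply, Fin.sum_univ_two]
  have hdiag : slash k (Hmat 11) (slash k !![3, 0; 0, 1] f) = ε • slash k !![1, 0; 0, 3] f := by
    rw [← slash_smul, ← hH, ← slash_mul k (by simp [Matrix.det_fin_two]) hHdet,
      ← slash_mul k hHdet (by simp [Matrix.det_fin_two])]
    congr 1
    ext i j
    fin_cases i <;> fin_cases j <;> norm_num [Hmat, Matrix.mul_apply, Fin.sum_univ_two]
  have hdiag' : slash k (Hmat 11) (slash k !![1, 0; 0, 3] f) = ε • slash k !![3, 0; 0, 1] f := by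
    rw [← slash_smul, ← hH, ← slash_mul k (by simp [Matrix.det_fin_two]) hHdet,
      ← slash_mul k hHdet (by simp [Matrix.det_fin_two])]
    congr 1
    ext i j
    fin_cases i <;> fin_cases j <;> norm_num [Hmat, Matrix.mul_apply, Fin.sum_univ_two]
  have hupper (b : ℝ) : slash k (Hmat 11) (slash k !![1, b; 0, 3] f) =
      ε • slash k !![3, 0; -11 * b, 1] f := by
    have hdet : 0 < (!![1, b; 0, 3] : Matrix (Fin 2) (Fin 2) ℝ).det := by
      simp [Matrix.det_fin_two]
    conv_lhs => rw [hfH, slash_smul, slash_smul, ← slash_mul k hHdet hdet]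
    rw [slash_slash_of_mul_eq_smul (r := -11) (η := !![3, 0; -11 * b, 1]) hk ?_ hHdet ?_
      (by norm_num) ?_]
    · rw [Matrix.det_mul]
      exact mul_pos hHdet hdet
    · simp [Matrix.det_fin_two]
    · ext i j
      fin_cases i <;> fin_cases j <;> simp [Hmat, Matrix.mul_apply, Fin.sum_univ_two] <;> ring
  have hplus := hupper 1
  have hminus := hupper (-1)
  norm_num at hplus hminus
  have hsum := congrArg (slash k (Hmat 11)) h3
  rw [slash_smul, hH, smul_comm, ← h3, hecke_three, hshift, slash_add, slash_add, slash_add,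
    hdiag, hdiag', hplus, hminus] at hsum
  funext z
  have hz := congrFun hsum z
  simp only [Pi.add_apply, Pi.smul_apply, smul_eq_mul] at hz ⊢
  have hε0 : ε ≠ 0 := left_ne_zero_of_mul_eq_one hεε
  apply mul_left_cancel₀ hε0
  linear_combination hz

theorem T3_relation_level_11 (k : ℤ) (hk : 0 < k) (hke : Even k) (f : ℍ → ℂ)
    (ε : ℂ) (hε : ε = 1 ∨ ε = -1) (c₃ : ℂ)
    (hT : slash k Tmat f = f) (hH : slash k (Hmat 11) f = ε • f)
    (hW : slash k (Wmat 11) f = f) (h3 : hecke k 3 f = c₃ • f) :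
    slash k (betaMat (1 / 3)) (f - slash k !![(3 : ℝ), -1; -11, 4] f)
      + slash k (betaMat (-(1 / 3))) (f - slash k !![(3 : ℝ), 1; 11, 4] f) = 0 := by
  have hupper (b : ℝ) : slash k !![3, 0; 0, 1] (slash k !![1, b; 0, 3] f) =
      slash k (betaMat (b / 3)) f := by
    refine slash_slash_of_mul_eq_smul (r := 3) hke ?_ ?_ ?_ (by norm_num) ?_ f
    · simp [Matrix.det_fin_two]
    · simp [Matrix.det_fin_two]
    · simp [betaMat, Matrix.det_fin_two]
    · ext i j
      fin_cases i <;> fin_cases j <;>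
        simp [betaMat, Matrix.mul_apply, Fin.sum_univ_two] <;> ring
  have hlower (b : ℝ) (hb : b * b = 1) :
      slash k (betaMat (b / 3)) (slash k !![3, -b; -11 * b, 4] f) =
        slash k !![3, 0; 0, 1] (slash k !![3, 0; -11 * b, 1] f) := by
    conv_rhs => rw [← slash_mul k (by simp [Matrix.det_fin_two]) (by simp [Matrix.det_fin_two])]
    refine slash_slash_of_mul_eq_smul (r := 1 / 3) hke ?_ ?_ ?_ (by norm_num) ?_ f
    · simp only [Matrix.det_fin_two_of]
      linarith
    · simp [betaMat, Matrix.det_fin_two]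
    · simp [Matrix.det_fin_two]
    · ext i j
      fin_cases i <;> fin_cases j <;>
        simp [betaMat, Matrix.mul_apply, Fin.sum_univ_two] <;> linarith
  have hrel := congrArg (slash k !![3, 0; 0, 1])
    (slash_lower_add_eq_slash_upper_add hke hε hT hH h3)
  have hplus := hlower 1 (by norm_num)
  have hminus := hlower (-1) (by norm_num)
  simp only [mul_one, mul_neg, neg_neg, neg_div] at hplus hminus
  have huminus := hupper (-1)
  rw [neg_div] at huminus
  rw [slash_add, slash_add, hupper, huminus, ← hplus, ← hminus] at hrel
  rw [slash_sub, slash_sub, sub_add_sub_comm, sub_eq_zero]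
  exact hrel.symm
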